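/- arXiv:1311.5011 — 3 statements merged into one kernel-verified Lean document; each statement's English description precedes it below -/
import Mathlib

section
/- Let (P_1, ..., P_d, U = [[A, B], [C, D]]) be a GR-unitary colligation with transfer function S. Then for all z, w in the open unit polydisk D^d one has the Agler decomposition: I_{E*} − S(z) S(w)^* = Σ_{k=1}^{d} (1 − z_k · conj(w_k)) · C (I − Z(z)A)^{-1} P_k ((I − Z(w)A)^{-1})^* C^*, an identity of bounded operators on E*. -/
open ContinuousLinearMap

noncomputable section

variable {d : ℕ} {H E F : Type*}
  [NormedAddCommGroup H] [InnerProductSpace ℂ H] [CompleteSpace H]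
  [NormedAddCommGroup E] [InnerProductSpace ℂ E] [CompleteSpace E]
  [NormedAddCommGroup F] [InnerProductSpace ℂ F] [CompleteSpace F]

/-- `Z(z) = z₁ P₁ + ⋯ + z_d P_d`. -/
def Zop (P : Fin d → H →L[ℂ] H) (z : Fin d → ℂ) : H →L[ℂ] H :=
  ∑ k, z k • P k

/-- The transfer function `S(z) = D + C (I - Z(z)A)⁻¹ Z(z) B` of a Givone–Roesser
colligation.  (For `z` in the open unit polydisk `1 - Z(z)A` is invertible, so
`Ring.inverse` is its genuine inverse there.) -/
def transferFn (P : Fin d → H →L[ℂ] H) (A : H →L[ℂ] H) (B : E →L[ℂ] H)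
    (C : H →L[ℂ] F) (D : E →L[ℂ] F) (z : Fin d → ℂ) : E →L[ℂ] F :=
  D + C ∘L Ring.inverse (1 - Zop P z * A) ∘L (Zop P z ∘L B)

theorem adjoint_Zop (P : Fin d → H →L[ℂ] H) (hPsa : ∀ k, IsSelfAdjoint (P k)) (w : Fin d → ℂ) :
    adjoint (Zop P w) = Zop P (fun k => (starRingEnd ℂ) (w k)) := by
  simp only [Zop, map_sum, LinearIsometryEquiv.map_smulₛₗ]
  exact Finset.sum_congr rfl fun k _ => by rw [(isSelfAdjoint_iff'.mp (hPsa k))]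

theorem Zop_mul_Zop (P : Fin d → H →L[ℂ] H) (hPidem : ∀ k, P k * P k = P k)
    (hPorth : ∀ j k, j ≠ k → P j * P k = 0) (z w : Fin d → ℂ) :
    Zop P z * Zop P w = Zop P (fun k => z k * w k) := by
  simp only [Zop, Finset.sum_mul_sum, smul_mul_smul_comm]
  refine Finset.sum_congr rfl fun k _ => ?_
  rw [Finset.sum_eq_single k, hPidem]
  · intro j _ hj
    rw [hPorth k j hj.symm, smul_zero]
  · simp

theorem norm_sq_Zop_apply (P : Fin d → H →L[ℂ] H) (hPsa : ∀ k, IsSelfAdjoint (P k))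
    (hPidem : ∀ k, P k * P k = P k) (hPorth : ∀ j k, j ≠ k → P j * P k = 0)
    (z : Fin d → ℂ) (x : H) : ‖Zop P z x‖ ^ 2 = ∑ k, ‖z k‖ ^ 2 * ‖P k x‖ ^ 2 := by
  have hP (k : Fin d) : ‖P k x‖ ^ 2 = RCLike.re (inner ℂ (P k x) x) := by
    rw [apply_norm_sq_eq_inner_adjoint_left, isSelfAdjoint_iff'.mp (hPsa k)]
    exact congrArg (fun T : H →L[ℂ] H => RCLike.re (inner ℂ (T x) x)) (hPidem k)
  have h : adjoint (Zop P z) ∘L Zop P z = Zop P (fun k => (starRingEnd ℂ) (z k) * z k) := by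
    rw [adjoint_Zop P hPsa]
    exact Zop_mul_Zop P hPidem hPorth _ _
  rw [apply_norm_sq_eq_inner_adjoint_left, h]
  simp only [Zop, sum_apply, sum_inner, map_sum]
  refine Finset.sum_congr rfl fun k _ => ?_
  rw [hP, Complex.conj_mul', smul_apply, inner_smul_left, ← Complex.ofReal_pow,
    Complex.conj_ofReal]
  exact Complex.re_ofReal_mul _ _

theorem norm_Zop_lt_one (P : Fin d → H →L[ℂ] H) (hPsa : ∀ k, IsSelfAdjoint (P k))
    (hPidem : ∀ k, P k * P k = P k) (hPorth : ∀ j k, j ≠ k → P j * P k = 0)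
    (hPsum : ∑ k, P k = 1) (z : Fin d → ℂ) (hz : ∀ k, ‖z k‖ < 1) : ‖Zop P z‖ < 1 := by
  obtain ⟨r, hr0, hr1, hr⟩ : ∃ r : ℝ, 0 ≤ r ∧ r < 1 ∧ ∀ k, ‖z k‖ ≤ r :=
    ⟨‖z‖, norm_nonneg z, (pi_norm_lt_iff one_pos).mpr hz, norm_le_pi_norm z⟩
  refine lt_of_le_of_lt (opNorm_le_bound _ hr0 fun x => ?_) hr1
  refine le_of_sq_le_sq ?_ (by positivity)
  have hx : ‖x‖ ^ 2 = ∑ k, ‖P k x‖ ^ 2 := by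
    simpa [Zop, hPsum] using norm_sq_Zop_apply P hPsa hPidem hPorth (fun _ => 1) x
  rw [norm_sq_Zop_apply P hPsa hPidem hPorth, mul_pow, hx, Finset.mul_sum]
  gcongr with k
  exact hr k

theorem norm_le_one_of_adjoint_mul_self_add (A : H →L[ℂ] H) (C : H →L[ℂ] F)
    (h : adjoint A * A + adjoint C ∘L C = 1) : ‖A‖ ≤ 1 := by
  refine opNorm_le_bound _ zero_le_one fun x => ?_
  rw [one_mul]
  refine le_of_sq_le_sq ?_ (norm_nonneg x)
  have hx : ‖A x‖ ^ 2 + ‖C x‖ ^ 2 = ‖x‖ ^ 2 := by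
    rw [apply_norm_sq_eq_inner_adjoint_left, apply_norm_sq_eq_inner_adjoint_left, ← map_add,
      ← inner_add_left, ← inner_self_eq_norm_sq (𝕜 := ℂ) x]
    exact congrArg (fun T : H →L[ℂ] H => RCLike.re (inner ℂ (T x) x)) h
  nlinarith [sq_nonneg ‖C x‖]

theorem isUnit_one_sub_Zop_mul (P : Fin d → H →L[ℂ] H) (hPsa : ∀ k, IsSelfAdjoint (P k))
    (hPidem : ∀ k, P k * P k = P k) (hPorth : ∀ j k, j ≠ k → P j * P k = 0)
    (hPsum : ∑ k, P k = 1) (A : H →L[ℂ] H) (hA : ‖A‖ ≤ 1)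
    (z : Fin d → ℂ) (hz : ∀ k, ‖z k‖ < 1) : IsUnit (1 - Zop P z * A) := by
  refine isUnit_one_sub_of_norm_lt_one ?_
  calc ‖Zop P z * A‖ ≤ ‖Zop P z‖ * ‖A‖ := norm_mul_le _ _
    _ ≤ ‖Zop P z‖ := mul_le_of_le_one_right (norm_nonneg _) hA
    _ < 1 := norm_Zop_lt_one P hPsa hPidem hPorth hPsum z hz

/-- The resolvent identity behind the decomposition: here `R` plays the role of
`(1 - X A)⁻¹` and `Q` that of `(1 - A' Y)⁻¹`. -/
theorem resolvent_identity {M : Type*} [Ring M] {A A' X Y R Q : M}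
    (hR : R * (1 - X * A) = 1) (hQ : (1 - A' * Y) * Q = 1) :
    1 + R * X * A + A' * (Y * Q) - R * X * (1 - A * A') * (Y * Q) = R * (1 - X * Y) * Q := by
  have h1 : R * X * A = R - 1 := by
    rw [mul_sub, mul_one] at hR
    rw [mul_assoc, ← hR]; abel
  have h2 : A' * (Y * Q) = Q - 1 := by
    rw [sub_mul, one_mul] at hQ
    rw [← mul_assoc, ← hQ]; abel
  have h3 : R * X * (1 - A * A') * (Y * Q)
      = R * X * Y * Q - (R * X * A) * (A' * (Y * Q)) := by noncomm_ring
  rw [h3, h1, h2]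
  noncomm_ring

/-- **Agler decomposition from a GR-unitary colligation.**
If `(P₁, …, P_d, [[A,B],[C,D]])` is a Givone–Roesser unitary colligation with transfer
function `S`, then for all `z, w` in the open unit polydisk,
`I - S(z)S(w)* = ∑ₖ (1 - zₖ conj(wₖ)) C (I - Z(z)A)⁻¹ Pₖ ((I - Z(w)A)⁻¹)* C*`. -/
theorem agler_decomposition_of_GR_unitary_colligation
    (hd : 0 < d)
    (P : Fin d → H →L[ℂ] H)
    (hPsa : ∀ k, IsSelfAdjoint (P k))
    (hPidem : ∀ k, P k * P k = P k)
    (hPorth : ∀ j k, j ≠ k → P j * P k = 0)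
    (hPsum : ∑ k, P k = 1)
    (A : H →L[ℂ] H) (B : E →L[ℂ] H) (C : H →L[ℂ] F) (D : E →L[ℂ] F)
    (hU1 : A * adjoint A + B ∘L adjoint B = 1)
    (hU2 : A ∘L adjoint C + B ∘L adjoint D = 0)
    (hU3 : C ∘L adjoint C + D ∘L adjoint D = 1)
    (hU4 : adjoint A * A + adjoint C ∘L C = 1)
    (hU5 : adjoint A ∘L B + adjoint C ∘L D = 0)
    (hU6 : adjoint B ∘L B + adjoint D ∘L D = 1)
    (z w : Fin d → ℂ) (hz : ∀ k, ‖z k‖ < 1) (hw : ∀ k, ‖w k‖ < 1) :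
    (1 : F →L[ℂ] F) - transferFn P A B C D z ∘L adjoint (transferFn P A B C D w)
      = ∑ k, (1 - z k * (starRingEnd ℂ) (w k)) •
          (C ∘L Ring.inverse (1 - Zop P z * A) ∘L P k ∘L
            adjoint (Ring.inverse (1 - Zop P w * A)) ∘L adjoint C) := by
  have hA := norm_le_one_of_adjoint_mul_self_add A C hU4
  have hR := Ring.inverse_mul_cancel _
    (isUnit_one_sub_Zop_mul P hPsa hPidem hPorth hPsum A hA z hz)
  have hQ := congrArg adjoint (Ring.inverse_mul_cancel _
    (isUnit_one_sub_Zop_mul P hPsa hPidem hPorth hPsum A hA w hw))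
  unfold transferFn
  set R := Ring.inverse (1 - Zop P z * A)
  set T := Ring.inverse (1 - Zop P w * A)
  set X := Zop P z
  have hQ' : (1 - adjoint A * adjoint (Zop P w)) * adjoint T = 1 := by
    simpa only [← star_eq_adjoint, star_mul, star_sub, star_one] using hQ
  have hXY : 1 - X * adjoint (Zop P w) = ∑ k, (1 - z k * (starRingEnd ℂ) (w k)) • P k := by
    rw [adjoint_Zop P hPsa, Zop_mul_Zop P hPidem hPorth]
    simp only [Zop, sub_smul, one_smul, Finset.sum_sub_distrib, hPsum]
  have key := resolvent_identity hR hQ'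
  rw [hXY] at key
  set Y := adjoint (Zop P w)
  have hBB : B ∘L adjoint B = 1 - A * adjoint A := eq_sub_of_add_eq' hU1
  have hBD : B ∘L adjoint D = -(A ∘L adjoint C) := eq_neg_of_add_eq_zero_right hU2
  have hDB : D ∘L adjoint B = -(C ∘L adjoint A) := by
    simpa only [adjoint_comp, adjoint_adjoint, map_neg] using congrArg adjoint hBD
  have hDD : D ∘L adjoint D = 1 - C ∘L adjoint C := eq_sub_of_add_eq' hU3
  have hS : (D + C ∘L R ∘L (X ∘L B)) ∘L adjoint (D + C ∘L T ∘L (Zop P w ∘L B))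
      = D ∘L adjoint D + C ∘L (R * X) ∘L (B ∘L adjoint D)
        + (D ∘L adjoint B) ∘L (Y * adjoint T) ∘L adjoint C
        + C ∘L (R * X) ∘L (B ∘L adjoint B) ∘L (Y * adjoint T) ∘L adjoint C := by
    simp only [map_add, adjoint_comp, add_comp, comp_add, mul_def, comp_assoc, Y]
    abel
  have hL : (1 : F →L[ℂ] F)
        - (D + C ∘L R ∘L (X ∘L B)) ∘L adjoint (D + C ∘L T ∘L (Zop P w ∘L B))
      = C ∘L (1 + R * X * A + adjoint A * (Y * adjoint T)
          - R * X * (1 - A * adjoint A) * (Y * adjoint T)) ∘L adjoint C := by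
    rw [hS, hBB, hBD, hDB, hDD]
    simp only [mul_def, one_def, add_comp, comp_add, sub_comp, comp_sub, neg_comp, comp_neg,
      comp_assoc, id_comp, comp_id]
    abel
  rw [hL, key]
  ext v
  simp [mul_def, Finset.mul_sum, Finset.sum_mul, map_sum]
end
end

section
/- Asymptotically Toeplitz behavior of the kernels in the Agler decomposition of a GR-unitary colligation: let (P_1, ..., P_d, U = [[A, B], [C, D]]) be a GR-unitary colligation. Fix k ∈ {1, ..., d} and α, β ∈ ℤ_+^d, and let e_k denote the k-th standard basis vector of ℤ^d. Then there exists a bounded operator T on E* such that for every x ∈ E*, ‖ C (A^𝔞)^{α + s·e_k} P_k ((A^𝔞)^{β + s·e_k})^* C^* x − T x ‖ → 0 as s → ∞ (s ∈ ℕ). (These operators are the Laurent coefficients of the shifted formal kernels z_k^{−s} w_k^{s} K_k^{11}(z, w) with K_k^{11}(z, w) = C(I − Z(z)A)^{-1} P_k (I − A^* Z(w)^{-1})^{-1} C^*, so the kernel K_k^{11} is asymptotically Toeplitz in the k-th direction.) -/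
open ContinuousLinearMap Filter

noncomputable section

variable {d : ℕ} {H E F : Type*}
  [NormedAddCommGroup H] [InnerProductSpace ℂ H] [CompleteSpace H]
  [NormedAddCommGroup E] [InnerProductSpace ℂ E] [CompleteSpace E]
  [NormedAddCommGroup F] [InnerProductSpace ℂ F] [CompleteSpace F]

/-- `A^w = P_{i_N} A P_{i_{N-1}} A ⋯ P_{i_1} A` for a word `w = i_N i_{N-1} ⋯ i_1`
with letters in `{1, …, d}`. -/
def grWord (A : H →L[ℂ] H) (P : Fin d → H →L[ℂ] H) {N : ℕ} (w : Fin N → Fin d) :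
    H →L[ℂ] H :=
  (List.ofFn fun j => P (w j) * A).prod

/-- The abelianized Givone–Roesser functional calculus
`(A^𝔞)^n = ∑_{w : 𝔞(w) = n} A^w`, a finite sum over all words `w` in the letters
`{1, …, d}` whose letter-count vector is `n`. -/
def grAb (A : H →L[ℂ] H) (P : Fin d → H →L[ℂ] H) (n : Fin d → ℕ) : H →L[ℂ] H :=
  ∑ w ∈ Finset.univ.filter
      (fun w : Fin (∑ k, n k) → Fin d =>
        ∀ k, (Finset.univ.filter fun j => w j = k).card = n k),
    grWord A P w

/-- The multi-index `α + s·e_k`. -/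
def lineShift (k : Fin d) (α : Fin d → ℕ) (s : ℕ) : Fin d → ℕ :=
  fun j => α j + if j = k then s else 0

/-- The sum of `A^w` over the words of length `N` with letter-count vector `n`. -/
def wordSum (A : H →L[ℂ] H) (P : Fin d → H →L[ℂ] H) (N : ℕ) (n : Fin d → ℕ) : H →L[ℂ] H :=
  ∑ w : Fin N → Fin d,
    if ∀ k, (Finset.univ.filter fun j => w j = k).card = n k then grWord A P w else 0

omit [CompleteSpace H] in
lemma grAb_eq_wordSum (A : H →L[ℂ] H) (P : Fin d → H →L[ℂ] H) {N : ℕ} {n : Fin d → ℕ}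
    (h : ∑ k, n k = N) : grAb A P n = wordSum A P N n := by
  subst h
  rw [grAb, wordSum, Finset.sum_filter]

omit [CompleteSpace H] in
lemma grWord_snoc (A : H →L[ℂ] H) (P : Fin d → H →L[ℂ] H) {N : ℕ} (w : Fin N → Fin d)
    (i : Fin d) :
    grWord A P (Fin.snoc w i : Fin (N + 1) → Fin d) = grWord A P w * (P i * A) := by
  rw [grWord, List.ofFn_succ_last]
  simp [grWord]

lemma card_filter_snoc {N : ℕ} (w : Fin N → Fin d) (i k : Fin d) :
    (Finset.univ.filter fun j => (Fin.snoc w i : Fin (N + 1) → Fin d) j = k).card =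
      (Finset.univ.filter fun j => w j = k).card + if i = k then 1 else 0 := by
  simp only [Finset.card_filter]
  rw [Fin.sum_univ_castSucc]
  simp

lemma add_ite_eq_iff (c n : Fin d → ℕ) (i : Fin d) :
    (∀ k, c k + (if i = k then 1 else 0) = n k) ↔
      n i ≠ 0 ∧ ∀ k, c k = (n - Pi.single i 1 : Fin d → ℕ) k := by
  constructor
  · intro h
    refine ⟨by have := h i; simp at this; omega, fun k => ?_⟩
    have := h k
    by_cases hk : i = k
    · subst hk; simp at this ⊢; omega
    · simpa [hk, Ne.symm hk] using this
  · rintro ⟨h0, h⟩ k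
    have := h k
    by_cases hk : i = k
    · subst hk; simp at this ⊢; omega
    · simpa [hk, Ne.symm hk] using this

omit [CompleteSpace H] in
lemma wordSum_succ (A : H →L[ℂ] H) (P : Fin d → H →L[ℂ] H) (N : ℕ) (n : Fin d → ℕ) :
    wordSum A P (N + 1) n =
      ∑ i, if n i = 0 then 0 else wordSum A P N (n - Pi.single i 1) * (P i * A) := by
  rw [wordSum, ← (Fin.snocEquiv fun _ : Fin (N + 1) => Fin d).sum_comp, Fintype.sum_prod_type]
  refine Finset.sum_congr rfl fun i _ => ?_
  have hterm (w : Fin N → Fin d) :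
      (if ∀ k, (Finset.univ.filter fun j =>
          (Fin.snoc w i : Fin (N + 1) → Fin d) j = k).card = n k
        then grWord A P (Fin.snoc w i : Fin (N + 1) → Fin d) else 0) =
      if n i ≠ 0 ∧ ∀ k, (Finset.univ.filter fun j => w j = k).card =
          (n - Pi.single i 1 : Fin d → ℕ) k
        then grWord A P w * (P i * A) else 0 := by
    simp only [card_filter_snoc, grWord_snoc]
    exact if_congr (add_ite_eq_iff _ n i) rfl rfl
  refine (Finset.sum_congr rfl fun w _ => hterm w).trans ?_
  by_cases h : n i = 0
  · simp [h]
  · simp [h, wordSum, Finset.sum_mul, ite_mul]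

omit [CompleteSpace H] in
/-- Splitting off the last letter of each word. -/
lemma grAb_eq_sum (A : H →L[ℂ] H) (P : Fin d → H →L[ℂ] H) {n : Fin d → ℕ} (hn : n ≠ 0) :
    grAb A P n = ∑ i, if n i = 0 then 0 else grAb A P (n - Pi.single i 1) * (P i * A) := by
  obtain ⟨N, hN⟩ : ∃ N, ∑ k, n k = N + 1 := by
    refine Nat.exists_eq_succ_of_ne_zero fun h => hn ?_
    ext k
    simpa using (Finset.sum_eq_zero_iff.mp h) k (Finset.mem_univ k)
  rw [grAb_eq_wordSum A P hN, wordSum_succ]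
  refine Finset.sum_congr rfl fun i _ => ?_
  split_ifs with h
  · rfl
  · rw [grAb_eq_wordSum A P (N := N)]
    have h1 : n = (n - Pi.single i 1) + Pi.single i 1 := by
      ext k
      by_cases hk : k = i
      · subst hk; simp; omega
      · simp [hk]
    have h2 : ∑ k, n k = ∑ k, (n - Pi.single i 1 : Fin d → ℕ) k + 1 := by
      conv_lhs => rw [h1]
      simp [Finset.sum_add_distrib]
    omega

/-- A sequence of operators whose column is bounded into `ℓ²`. -/
def ColumnBounded {G : Type*} [NormedAddCommGroup G] [InnerProductSpace ℂ G]
    (X : ℕ → F →L[ℂ] G) : Prop :=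
  ∃ c : ℝ, 0 ≤ c ∧ ∀ N x, ∑ s ∈ Finset.range N, ‖X s x‖ ^ 2 ≤ c * ‖x‖ ^ 2

section ColumnBounded

variable {G : Type*} [NormedAddCommGroup G] [InnerProductSpace ℂ G] [CompleteSpace G]

omit [CompleteSpace F] [CompleteSpace G] in
lemma columnBounded_zero : ColumnBounded (fun _ => (0 : F →L[ℂ] G)) :=
  ⟨0, le_rfl, by simp⟩

lemma ColumnBounded.summable_adjoint_apply {X Y : ℕ → F →L[ℂ] G} (hX : ColumnBounded X)
    (hY : ColumnBounded Y) (x : F) : Summable fun s => adjoint (Y s) (X s x) := by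
  obtain ⟨c, hc, hX⟩ := hX
  obtain ⟨e, he, hY⟩ := hY
  have hsX : Summable fun s => ‖X s x‖ ^ 2 :=
    summable_of_sum_range_le (fun _ => by positivity) fun N => hX N x
  have hYt (t : Finset ℕ) (y : F) : ∑ s ∈ t, ‖Y s y‖ ^ 2 ≤ e * ‖y‖ ^ 2 := by
    obtain ⟨N, hN⟩ := t.exists_nat_subset_range
    exact (Finset.sum_le_sum_of_subset_of_nonneg hN fun _ _ _ => by positivity).trans (hY N y)
  have key (t : Finset ℕ) :
      ‖∑ s ∈ t, adjoint (Y s) (X s x)‖ ^ 2 ≤ e * ∑ s ∈ t, ‖X s x‖ ^ 2 := by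
    set u := ∑ s ∈ t, adjoint (Y s) (X s x) with hu
    have h1 : ‖u‖ ^ 2 ≤ ∑ s ∈ t, ‖X s x‖ * ‖Y s u‖ := by
      have : ‖u‖ ^ 2 = ∑ s ∈ t, RCLike.re (inner ℂ (X s x) (Y s u)) := by
        rw [← inner_self_eq_norm_sq (𝕜 := ℂ) u]
        conv_lhs => enter [2, 2]; rw [hu]
        rw [sum_inner, map_sum]
        simp [adjoint_inner_left]
      rw [this]
      exact Finset.sum_le_sum fun s _ => re_inner_le_norm _ _
    have h2 := Finset.sum_mul_sq_le_sq_mul_sq t (fun s => ‖X s x‖) (fun s => ‖Y s u‖)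
    have h3 : 0 ≤ ∑ s ∈ t, ‖X s x‖ ^ 2 := Finset.sum_nonneg fun _ _ => by positivity
    rcases eq_or_ne u 0 with h0 | h0
    · rw [h0]; simp; positivity
    · have hpos : 0 < ‖u‖ ^ 2 := by positivity
      have h4 : (‖u‖ ^ 2) ^ 2 ≤ (∑ s ∈ t, ‖X s x‖ ^ 2) * (e * ‖u‖ ^ 2) :=
        (pow_le_pow_left₀ hpos.le h1 2).trans
          (h2.trans (mul_le_mul_of_nonneg_left (hYt t u) h3))
      refine le_of_mul_le_mul_right ?_ hpos
      linarith
  rw [summable_iff_vanishing_norm]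
  intro ε hε
  obtain ⟨s, hs⟩ := (summable_iff_vanishing_norm.mp hsX) (ε ^ 2 / (e + 1)) (by positivity)
  refine ⟨s, fun t ht => ?_⟩
  have h1 := (abs_lt.mp (hs t ht)).2
  have h3 : 0 ≤ ∑ s ∈ t, ‖X s x‖ ^ 2 := Finset.sum_nonneg fun _ _ => by positivity
  rw [lt_div_iff₀ (by positivity)] at h1
  refine lt_of_pow_lt_pow_left₀ 2 hε.le ((key t).trans_lt ?_)
  linarith

end ColumnBounded

/-- The part of the state at `n` that arrives from `n - e_j`. -/
def incoming (P : Fin d → H →L[ℂ] H) (K : (Fin d → ℕ) → F →L[ℂ] H) (j : Fin d)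
    (n : Fin d → ℕ) : F →L[ℂ] H :=
  if n j = 0 then 0 else P j ∘L K (n - Pi.single j 1)

section Energy

variable {P : Fin d → H →L[ℂ] H} {A : H →L[ℂ] H} {B : E →L[ℂ] H}
  {K : (Fin d → ℕ) → F →L[ℂ] H}

lemma inner_apply_apply_of_ne (hPsa : ∀ k, IsSelfAdjoint (P k))
    (hPorth : ∀ j k, j ≠ k → P j * P k = 0) {i j : Fin d} (hij : i ≠ j) (u v : H) :
    inner ℂ (P i u) (P j v) = 0 := by
  have h : P i (P j v) = 0 := congrArg (fun L : H →L[ℂ] H => L v) (hPorth i j hij)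
  rw [← adjoint_inner_right, (hPsa i).adjoint_eq, h, inner_zero_right]

lemma inner_sum_apply_sum_apply (hPsa : ∀ k, IsSelfAdjoint (P k))
    (hPorth : ∀ j k, j ≠ k → P j * P k = 0) (u v : Fin d → H) :
    inner ℂ (∑ j, P j (u j)) (∑ j, P j (v j)) = ∑ j, inner ℂ (P j (u j)) (P j (v j)) := by
  rw [sum_inner]
  refine Finset.sum_congr rfl fun i _ => ?_
  rw [inner_sum]
  exact Finset.sum_eq_single i
    (fun j _ hj => inner_apply_apply_of_ne hPsa hPorth hj.symm _ _) (by simp)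

omit [CompleteSpace F] in
/-- Energy balance at the pair of nodes `n`, `m`. -/
lemma energy_balance (hPsa : ∀ k, IsSelfAdjoint (P k))
    (hPorth : ∀ j k, j ≠ k → P j * P k = 0) (hPsum : ∑ k, P k = 1)
    (hU1 : A * adjoint A + B ∘L adjoint B = 1)
    (hK : ∀ n, n ≠ 0 → K n = adjoint A ∘L ∑ j, incoming P K j n)
    {n m : Fin d → ℕ} (hn : n ≠ 0) (hm : m ≠ 0) (x y : F) :
    ∑ j, inner ℂ (P j (K n x)) (P j (K m y)) +
      inner ℂ (adjoint B (∑ j, incoming P K j n x)) (adjoint B (∑ j, incoming P K j m y)) =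
      ∑ j, inner ℂ (incoming P K j n x) (incoming P K j m y) := by
  have hsum (u : H) : ∑ j, P j u = u := by
    rw [← sum_apply, hPsum]
    rfl
  have hin (n : Fin d → ℕ) (x : F) (j : Fin d) :
      incoming P K j n x = P j (if n j = 0 then 0 else K (n - Pi.single j 1) x) := by
    rw [incoming]; split_ifs <;> simp
  rw [← inner_sum_apply_sum_apply hPsa hPorth (fun _ => K n x) (fun _ => K m y), hsum, hsum,
    hK n hn, hK m hm]
  simp only [comp_apply, sum_apply]
  rw [adjoint_inner_left, adjoint_inner_left, ← inner_add_right]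
  have : A (adjoint A (∑ j, incoming P K j m y)) + B (adjoint B (∑ j, incoming P K j m y)) =
      ∑ j, incoming P K j m y :=
    congrArg (fun L : H →L[ℂ] H => L (∑ j, incoming P K j m y)) hU1
  rw [this]
  simp only [hin]
  exact inner_sum_apply_sum_apply hPsa hPorth _ _

lemma lineShift_succ_ne_zero (k : Fin d) (α : Fin d → ℕ) (s : ℕ) :
    lineShift k α (s + 1) ≠ 0 := fun h => by
  simpa [lineShift] using congrFun h k

omit [CompleteSpace H] [CompleteSpace F] in
lemma incoming_lineShift_self (k : Fin d) (α : Fin d → ℕ) (s : ℕ) :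
    incoming P K k (lineShift k α (s + 1)) = P k ∘L K (lineShift k α s) := by
  have : lineShift k α (s + 1) - Pi.single k 1 = lineShift k α s := by
    ext j
    by_cases h : j = k
    · subst h; simp [lineShift]
    · simp [lineShift, h]
  rw [incoming, this, if_neg (by simp [lineShift])]

omit [CompleteSpace H] [CompleteSpace F] in
lemma incoming_lineShift_of_ne {j k : Fin d} (hj : j ≠ k) (α : Fin d → ℕ) (s : ℕ) :
    incoming P K j (lineShift k α s) =
      if α j = 0 then 0 else P j ∘L K (lineShift k (α - Pi.single j 1) s) := by
  have h0 : lineShift k α s j = α j := by simp [lineShift, hj]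
  rw [incoming, h0]
  split_ifs with h
  · rfl
  · congr 2
    ext i
    by_cases hi : i = j
    · subst hi; simp [lineShift, hj]
    · simp [lineShift, hi]

omit [CompleteSpace H] [CompleteSpace F] in
lemma columnBounded_incoming {j k : Fin d} (hj : j ≠ k) (α : Fin d → ℕ)
    (h : α j ≠ 0 → ColumnBounded fun s => P j ∘L K (lineShift k (α - Pi.single j 1) (s + 1))) :
    ColumnBounded fun s => incoming P K j (lineShift k α (s + 1)) := by
  simp only [incoming_lineShift_of_ne hj]
  by_cases h0 : α j = 0
  · simpa [h0] using columnBounded_zero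
  · simpa [h0] using h h0

omit [CompleteSpace F] in
/-- If the incoming parts from the directions other than `k` are bounded on the line
`α + ℕ·e_k`, then so are the outgoing parts in those directions and the outputs. -/
lemma columnBounded_of_incoming (hPsa : ∀ k, IsSelfAdjoint (P k))
    (hPorth : ∀ j k, j ≠ k → P j * P k = 0) (hPsum : ∑ k, P k = 1)
    (hU1 : A * adjoint A + B ∘L adjoint B = 1)
    (hK : ∀ n, n ≠ 0 → K n = adjoint A ∘L ∑ j, incoming P K j n) (k : Fin d) (α : Fin d → ℕ)
    (h : ∀ j, j ≠ k → ColumnBounded fun s => incoming P K j (lineShift k α (s + 1))) :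
    (∀ j, j ≠ k → ColumnBounded fun s => P j ∘L K (lineShift k α (s + 1))) ∧
      ColumnBounded fun s => adjoint B ∘L ∑ j, incoming P K j (lineShift k α (s + 1)) := by
  have h' : ∀ j, ∃ c : ℝ, 0 ≤ c ∧ (j ≠ k → ∀ N x,
      ∑ s ∈ Finset.range N, ‖incoming P K j (lineShift k α (s + 1)) x‖ ^ 2 ≤ c * ‖x‖ ^ 2) := by
    intro j
    by_cases hj : j = k
    · exact ⟨0, le_rfl, fun h => absurd hj h⟩
    · obtain ⟨c, hc, hb⟩ := h j hj
      exact ⟨c, hc, fun _ => hb⟩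
  choose c hc hb using h'
  have balance (s : ℕ) (x : F) :
      ‖P k (K (lineShift k α (s + 1)) x)‖ ^ 2 +
        ∑ j ∈ Finset.univ.erase k, ‖P j (K (lineShift k α (s + 1)) x)‖ ^ 2 +
        ‖adjoint B (∑ j, incoming P K j (lineShift k α (s + 1)) x)‖ ^ 2 =
      ‖P k (K (lineShift k α s) x)‖ ^ 2 +
        ∑ j ∈ Finset.univ.erase k, ‖incoming P K j (lineShift k α (s + 1)) x‖ ^ 2 := by
    have e := energy_balance hPsa hPorth hPsum hU1 hK (lineShift_succ_ne_zero k α s)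
      (lineShift_succ_ne_zero k α s) x x
    simp only [inner_self_eq_norm_sq_to_K] at e
    have e' : ∑ j, ‖P j (K (lineShift k α (s + 1)) x)‖ ^ 2 +
        ‖adjoint B (∑ j, incoming P K j (lineShift k α (s + 1)) x)‖ ^ 2 =
        ∑ j, ‖incoming P K j (lineShift k α (s + 1)) x‖ ^ 2 := by
      exact_mod_cast e
    rw [← Finset.add_sum_erase _ (fun j => ‖P j _‖ ^ 2) (Finset.mem_univ k),
      ← Finset.add_sum_erase _ (fun j => ‖incoming P K j _ x‖ ^ 2) (Finset.mem_univ k)] at e'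
    rw [incoming_lineShift_self] at e'
    exact e'
  set M : ℝ := ‖P k ∘L K (lineShift k α 0)‖ ^ 2 + ∑ j ∈ Finset.univ.erase k, c j with hM
  have hM0 : 0 ≤ M := by
    have : 0 ≤ ∑ j ∈ Finset.univ.erase k, c j := Finset.sum_nonneg fun j _ => hc j
    positivity
  have total (N : ℕ) (x : F) :
      ∑ s ∈ Finset.range N,
        (∑ j ∈ Finset.univ.erase k, ‖P j (K (lineShift k α (s + 1)) x)‖ ^ 2 +
          ‖adjoint B (∑ j, incoming P K j (lineShift k α (s + 1)) x)‖ ^ 2) ≤ M * ‖x‖ ^ 2 := by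
    have h1 : ∑ s ∈ Finset.range N,
        (∑ j ∈ Finset.univ.erase k, ‖P j (K (lineShift k α (s + 1)) x)‖ ^ 2 +
          ‖adjoint B (∑ j, incoming P K j (lineShift k α (s + 1)) x)‖ ^ 2) =
        ∑ s ∈ Finset.range N,
          (‖P k (K (lineShift k α s) x)‖ ^ 2 - ‖P k (K (lineShift k α (s + 1)) x)‖ ^ 2) +
        ∑ j ∈ Finset.univ.erase k, ∑ s ∈ Finset.range N,
          ‖incoming P K j (lineShift k α (s + 1)) x‖ ^ 2 := by
      rw [Finset.sum_comm (s := Finset.univ.erase k), ← Finset.sum_add_distrib]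
      refine Finset.sum_congr rfl fun s _ => ?_
      linarith [balance s x]
    rw [h1, Finset.sum_range_sub' (fun s => ‖P k (K (lineShift k α s) x)‖ ^ 2), hM, add_mul,
      Finset.sum_mul]
    have h2 : ‖P k (K (lineShift k α 0) x)‖ ^ 2 ≤
        ‖P k ∘L K (lineShift k α 0)‖ ^ 2 * ‖x‖ ^ 2 := by
      rw [← mul_pow]
      exact pow_le_pow_left₀ (norm_nonneg _) (le_opNorm (P k ∘L K (lineShift k α 0)) x) 2
    have h3 := Finset.sum_le_sum fun j (hj : j ∈ Finset.univ.erase k) =>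
      hb j (Finset.ne_of_mem_erase hj) N x
    have h4 : 0 ≤ ‖P k (K (lineShift k α N) x)‖ ^ 2 := by positivity
    linarith
  refine ⟨fun j hj => ⟨M, hM0, fun N x => le_trans (Finset.sum_le_sum fun s _ => ?_) (total N x)⟩,
    ⟨M, hM0, fun N x => le_trans (Finset.sum_le_sum fun s _ => ?_) (total N x)⟩⟩
  · have := Finset.single_le_sum (f := fun j => ‖P j (K (lineShift k α (s + 1)) x)‖ ^ 2)
      (fun _ _ => by positivity) (Finset.mem_erase.mpr ⟨hj, Finset.mem_univ j⟩)
    simp only [comp_apply]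
    refine this.trans (le_add_of_nonneg_right (by positivity))
  · simp only [comp_apply, sum_apply]
    exact le_add_of_nonneg_left (Finset.sum_nonneg fun _ _ => by positivity)

omit [CompleteSpace F] in
lemma columnBounded_outgoing (hPsa : ∀ k, IsSelfAdjoint (P k))
    (hPorth : ∀ j k, j ≠ k → P j * P k = 0) (hPsum : ∑ k, P k = 1)
    (hU1 : A * adjoint A + B ∘L adjoint B = 1)
    (hK : ∀ n, n ≠ 0 → K n = adjoint A ∘L ∑ j, incoming P K j n) (k : Fin d)
    (α : Fin d → ℕ) :
    ∀ j, j ≠ k → ColumnBounded fun s => P j ∘L K (lineShift k α (s + 1)) := by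
  induction hN : ∑ i, α i using Nat.strong_induction_on generalizing α with
  | _ N ih =>
    refine (columnBounded_of_incoming hPsa hPorth hPsum hU1 hK k α fun j hj =>
      columnBounded_incoming hj α fun h0 => ih _ ?_ _ rfl j hj).1
    rw [← hN]
    refine Finset.sum_lt_sum (fun i _ => by simp) ⟨j, Finset.mem_univ j, ?_⟩
    simp; omega

/-- The outgoing parts in the direction `k` are asymptotically Toeplitz along `e_k`. -/
lemma exists_tendsto_adjoint_outgoing (hPsa : ∀ k, IsSelfAdjoint (P k))
    (hPorth : ∀ j k, j ≠ k → P j * P k = 0) (hPsum : ∑ k, P k = 1)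
    (hU1 : A * adjoint A + B ∘L adjoint B = 1)
    (hK : ∀ n, n ≠ 0 → K n = adjoint A ∘L ∑ j, incoming P K j n) (k : Fin d)
    (α β : Fin d → ℕ) (x : F) :
    ∃ l, Tendsto (fun s =>
      adjoint (P k ∘L K (lineShift k α s)) ((P k ∘L K (lineShift k β s)) x)) atTop (nhds l) := by
  have hout := columnBounded_outgoing hPsa hPorth hPsum hU1 hK k
  have hin (α : Fin d → ℕ) (j : Fin d) (hj : j ≠ k) :
      ColumnBounded fun s => incoming P K j (lineShift k α (s + 1)) :=
    columnBounded_incoming hj α fun _ => hout _ j hj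
  have hB (α : Fin d → ℕ) := (columnBounded_of_incoming hPsa hPorth hPsum hU1 hK k α (hin α)).2
  set t : ℕ → F := fun s =>
    adjoint (P k ∘L K (lineShift k α s)) ((P k ∘L K (lineShift k β s)) x) with ht
  set f : ℕ → F := fun s =>
    ∑ j ∈ Finset.univ.erase k, adjoint (incoming P K j (lineShift k α (s + 1)))
        (incoming P K j (lineShift k β (s + 1)) x) -
      ∑ j ∈ Finset.univ.erase k, adjoint (P j ∘L K (lineShift k α (s + 1)))
        ((P j ∘L K (lineShift k β (s + 1))) x) -
      adjoint (adjoint B ∘L ∑ j, incoming P K j (lineShift k α (s + 1)))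
        ((adjoint B ∘L ∑ j, incoming P K j (lineShift k β (s + 1))) x) with hf
  have hfs : Summable f := by
    refine (Summable.sub ?_ ?_).sub ((hB β).summable_adjoint_apply (hB α) x)
    · exact summable_sum fun j hj => (hin β j (Finset.ne_of_mem_erase hj)).summable_adjoint_apply
        (hin α j (Finset.ne_of_mem_erase hj)) x
    · exact summable_sum fun j hj => (hout β j (Finset.ne_of_mem_erase hj)).summable_adjoint_apply
        (hout α j (Finset.ne_of_mem_erase hj)) x
  have hstep (s : ℕ) : t (s + 1) - t s = f s := by
    refine ext_inner_left ℂ fun y => ?_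
    have e := energy_balance hPsa hPorth hPsum hU1 hK (lineShift_succ_ne_zero k α s)
      (lineShift_succ_ne_zero k β s) y x
    rw [← Finset.add_sum_erase _ (fun j => inner ℂ (P j _) (P j _)) (Finset.mem_univ k),
      ← Finset.add_sum_erase _ (fun j => inner ℂ (incoming P K j _ y) (incoming P K j _ x))
        (Finset.mem_univ k), incoming_lineShift_self,
      incoming_lineShift_self] at e
    simp only [ht, hf, inner_sub_right, inner_sum, adjoint_inner_right]
    simp only [comp_apply, sum_apply] at e ⊢
    linear_combination e
  refine ⟨t 0 + ∑' s, f s, ?_⟩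
  have hsum (N : ℕ) : t N = t 0 + ∑ s ∈ Finset.range N, f s := by
    simp only [← hstep, Finset.sum_range_sub]
    abel
  exact (tendsto_const_nhds.add hfs.hasSum.tendsto_sum_nat).congr fun N => (hsum N).symm

end Energy

/-- **Asymptotically Toeplitz behavior of the kernels in the Agler decomposition of a
GR-unitary colligation.**  For fixed `k` and `α, β ∈ ℤ₊^d`, the operators
`C (A^𝔞)^{α + s·e_k} P_k ((A^𝔞)^{β + s·e_k})* C*` converge strongly as `s → ∞`. -/
theorem agler_kernel_asymptotically_toeplitz
    (hd : 0 < d)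
    (P : Fin d → H →L[ℂ] H)
    (hPsa : ∀ k, IsSelfAdjoint (P k))
    (hPidem : ∀ k, P k * P k = P k)
    (hPorth : ∀ j k, j ≠ k → P j * P k = 0)
    (hPsum : ∑ k, P k = 1)
    (A : H →L[ℂ] H) (B : E →L[ℂ] H) (C : H →L[ℂ] F) (D : E →L[ℂ] F)
    (hU1 : A * adjoint A + B ∘L adjoint B = 1)
    (hU2 : A ∘L adjoint C + B ∘L adjoint D = 0)
    (hU3 : C ∘L adjoint C + D ∘L adjoint D = 1)
    (hU4 : adjoint A * A + adjoint C ∘L C = 1)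
    (hU5 : adjoint A ∘L B + adjoint C ∘L D = 0)
    (hU6 : adjoint B ∘L B + adjoint D ∘L D = 1)
    (k : Fin d) (α β : Fin d → ℕ) :
    ∃ T : F →L[ℂ] F, ∀ x : F,
      Tendsto
        (fun s : ℕ =>
          ‖(C ∘L grAb A P (fun j => α j + if j = k then s else 0) ∘L P k ∘L
              adjoint (grAb A P (fun j => β j + if j = k then s else 0)) ∘L adjoint C) x
            - T x‖)
        atTop (nhds 0) := by
  have hK : ∀ n : Fin d → ℕ, n ≠ 0 → adjoint (grAb A P n) ∘L adjoint C =
      adjoint A ∘L ∑ j, incoming P (fun n => adjoint (grAb A P n) ∘L adjoint C) j n := by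
    intro n hn
    ext x
    simp only [comp_apply, sum_apply]
    rw [grAb_eq_sum A P hn, map_sum, sum_apply, map_sum]
    refine Finset.sum_congr rfl fun j _ => ?_
    rw [incoming]
    split_ifs with h
    · simp
    · simp only [mul_def, adjoint_comp, comp_apply, (hPsa j).adjoint_eq]
  have hterm : ∀ s : ℕ,
      C ∘L grAb A P (lineShift k α s) ∘L P k ∘L
        adjoint (grAb A P (lineShift k β s)) ∘L adjoint C =
      adjoint (P k ∘L adjoint (grAb A P (lineShift k α s)) ∘L adjoint C) ∘L
        (P k ∘L adjoint (grAb A P (lineShift k β s)) ∘L adjoint C) := by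
    intro s
    ext x
    have hp (u : H) : P k (P k u) = P k u :=
      congrArg (fun L : H →L[ℂ] H => L u) (hPidem k)
    simp [adjoint_comp, (hPsa k).adjoint_eq, hp]
  choose l hl using exists_tendsto_adjoint_outgoing hPsa hPorth hPsum hU1 hK k α β
  refine ⟨continuousLinearMapOfTendsto (fun s =>
    adjoint (P k ∘L adjoint (grAb A P (lineShift k α s)) ∘L adjoint C) ∘L
      (P k ∘L adjoint (grAb A P (lineShift k β s)) ∘L adjoint C)) (f := l)
    (tendsto_pi_nhds.mpr hl), fun x => ?_⟩
  have h := tendsto_iff_norm_sub_tendsto_zero.mp (hl x)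
  refine h.congr fun s => ?_
  exact (congrArg (fun L : F →L[ℂ] F => ‖L x - l x‖) (hterm s)).symm
end
end

section
/- A strictly closely connected and shifted strictly closely connected GR-unitary colligation that is not scattering minimal: let A, B, C, D, P_1, P_2 be the 8×8, 8×3, 3×8, 3×3 and 8×8 complex matrices defined in the context, and for z = (z_1, z_2) ∈ ℂ² set Z(z) := z_1 P_1 + z_2 P_2. Then: (i) P_1 is a self-adjoint idempotent, so P_1 and P_2 = I_8 − P_1 are complementary orthogonal projections; (ii) the 11×11 block matrix U := [[A, B], [C, D]] is unitary; (iii) the nine vectors formed by the columns of P_1 B, the columns of P_2 B, and the columns of C^* span ℂ^8 (so the colligation is strictly closely connected); (iv) the nine vectors formed by the columns of B, the columns of P_1 C^*, and the columns of P_2 C^* span ℂ^8 (so it is shifted strictly closely connected); (v) for every z = (z_1, z_2) ∈ ℂ² with |z_1| = |z_2| = 1, the subspace V(z) := {(z_1 a, z_2 a, z_1 a, z_1 b, z_2 b, 0, 0, 0)^T : a, b ∈ ℂ} of ℂ^8 is two-dimensional and satisfies: C v = 0 and B^* Z(z)^* v = 0 for every v ∈ V(z), and Z(z)A · V(z) ⊆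 V(z) and (Z(z)A)^* · V(z) ⊆ V(z). (The nonzero pointwise-reducing family V(z) witnesses that the colligation is not scattering minimal.) -/
open scoped Matrix

noncomputable section

/-- `s = 1/√6`. -/
def sc : ℂ := ((Real.sqrt 6 : ℂ))⁻¹

/-- `t = √(2/3) = 2/√6`. -/
def tc : ℂ := 2 * sc

/-- The 8×8 matrix `A`. -/
def A8 : Matrix (Fin 8) (Fin 8) ℂ :=
  !![0, 0, 0, sc, sc, 0, 0, 0;
     0, 0, 0, 0, tc, 0, 0, 0;
     0, 0, 0, tc, 0, 0, 0, 0;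
     sc, 0, tc, 0, 0, 0, 0, 0;
     sc, tc, 0, 0, 0, 0, 0, 0;
     0, 0, 0, sc, -sc, 0, 0, 0;
     0, -sc, sc, 0, 0, 0, 0, 0;
     -tc, sc, sc, 0, 0, 0, 0, 0]

/-- The 8×3 matrix `B`. -/
def B8 : Matrix (Fin 8) (Fin 3) ℂ :=
  !![0, 0, -tc;
     0, -sc, sc;
     0, sc, sc;
     sc, 0, 0;
     -sc, 0, 0;
     0, -tc, 0;
     -tc, 0, 0;
     0, 0, 0]

/-- The 3×8 matrix `C` whose rows are `e₆ᵀ, e₇ᵀ, e₈ᵀ`. -/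
def C8 : Matrix (Fin 3) (Fin 8) ℂ :=
  !![0, 0, 0, 0, 0, 1, 0, 0;
     0, 0, 0, 0, 0, 0, 1, 0;
     0, 0, 0, 0, 0, 0, 0, 1]

/-- The 8×8 matrix `P₁`. -/
def P1 : Matrix (Fin 8) (Fin 8) ℂ :=
  !![5/6, 0, -(1/3), 0, 0, -(1/6), 0, 0;
     0, 0, 0, 0, 0, 0, 0, 0;
     -(1/3), 0, 1/3, 0, 0, -(1/3), 0, 0;
     0, 0, 0, 1, 0, 0, 0, 0;
     0, 0, 0, 0, 2/3, 0, -(1/3), 1/3;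
     -(1/6), 0, -(1/3), 0, 0, 5/6, 0, 0;
     0, 0, 0, 0, -(1/3), 0, 1/6, -(1/6);
     0, 0, 0, 0, 1/3, 0, -(1/6), 1/6]

/-- `P₂ = I₈ - P₁`. -/
def P2 : Matrix (Fin 8) (Fin 8) ℂ := 1 - P1

theorem sc_mul_sc : sc * sc = 1 / 6 := by
  have h : (Real.sqrt 6 : ℂ) * (Real.sqrt 6 : ℂ) = 6 := by
    rw [← Complex.ofReal_mul, Real.mul_self_sqrt (by norm_num)]
    norm_num
  rw [sc, ← mul_inv, h, one_div]

theorem star_sc : (starRingEnd ℂ) sc = sc := by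
  rw [sc, map_inv₀, Complex.conj_ofReal]

/-- If `M₁ X + M₂ Y + M₃ Z = 1`, then the columns of `M₁`, `M₂`, `M₃` span. -/
theorem span_cols_eq_top_of_mul_add_mul_add_mul_eq_one {n m : Type*} [Fintype n] [DecidableEq n]
    [Fintype m] {M₁ M₂ M₃ : Matrix n m ℂ} (X Y Z : Matrix m n ℂ)
    (h : M₁ * X + M₂ * Y + M₃ * Z = 1) :
    Submodule.span ℂ (Set.range M₁ᵀ ∪ Set.range M₂ᵀ ∪ Set.range M₃ᵀ) = ⊤ := by
  have key (M : Matrix n m ℂ) (w : m → ℂ) : M.mulVec w ∈ Submodule.span ℂ (Set.range Mᵀ) := by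
    have hr := Matrix.range_mulVecLin M
    rw [Matrix.col_def] at hr
    rw [← hr]
    exact ⟨w, rfl⟩
  rw [eq_top_iff, Submodule.span_union, Submodule.span_union]
  intro v _
  rw [← Matrix.one_mulVec v, ← h, Matrix.add_mulVec, Matrix.add_mulVec,
    ← Matrix.mulVec_mulVec, ← Matrix.mulVec_mulVec, ← Matrix.mulVec_mulVec]
  exact Submodule.add_mem_sup (Submodule.add_mem_sup (key _ _) (key _ _)) (key _ _)

theorem P1_conjTranspose : P1ᴴ = P1 := by
  ext i j
  fin_cases i <;> fin_cases j <;> simp [P1]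

theorem P1_mul_P1 : P1 * P1 = P1 := by
  ext i j
  fin_cases i <;> fin_cases j <;>
    simp [P1, Matrix.mul_apply, Fin.sum_univ_succ] <;> norm_num

theorem A8_conjTranspose : A8ᴴ = A8ᵀ := by
  ext i j
  fin_cases i <;> fin_cases j <;> simp [A8, tc, star_sc]

theorem B8_conjTranspose : B8ᴴ = B8ᵀ := by
  ext i j
  fin_cases i <;> fin_cases j <;> simp [B8, tc, star_sc]

theorem C8_conjTranspose : C8ᴴ = C8ᵀ := by
  ext i j
  fin_cases i <;> fin_cases j <;> simp [C8]

theorem star_fromBlocks_mul_self :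
    star (Matrix.fromBlocks A8 B8 C8 (0 : Matrix (Fin 3) (Fin 3) ℂ)) *
      Matrix.fromBlocks A8 B8 C8 (0 : Matrix (Fin 3) (Fin 3) ℂ) = 1 := by
  have h := sc_mul_sc
  rw [Matrix.star_eq_conjTranspose, Matrix.fromBlocks_conjTranspose, Matrix.fromBlocks_multiply,
    ← Matrix.fromBlocks_one, A8_conjTranspose, B8_conjTranspose, C8_conjTranspose]
  congr 1
  · ext i j
    fin_cases i <;> fin_cases j <;>
      simp [A8, C8, tc, Matrix.mul_apply, Fin.sum_univ_succ] <;> grind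
  · ext i j
    fin_cases i <;> fin_cases j <;>
      simp [A8, B8, tc, Matrix.mul_apply, Fin.sum_univ_succ] <;> grind
  · ext i j
    fin_cases i <;> fin_cases j <;>
      simp [A8, B8, tc, Matrix.mul_apply, Fin.sum_univ_succ] <;> grind
  · ext i j
    fin_cases i <;> fin_cases j <;>
      simp [B8, tc, Matrix.mul_apply, Fin.sum_univ_succ] <;> grind

theorem P1_mul_B8 : P1 * B8 = sc •
    !![0, 0, -2; 0, 0, 0; 0, 1, 1; 1, 0, 0; 0, 0, 0; 0, -2, 0; 0, 0, 0; 0, 0, 0] := by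
  ext i j
  fin_cases i <;> fin_cases j <;>
    simp [P1, B8, tc, Matrix.mul_apply, Fin.sum_univ_succ] <;> ring

theorem P2_mul_B8 : P2 * B8 = sc •
    !![0, 0, 0; 0, -1, 1; 0, 0, 0; 0, 0, 0; -1, 0, 0; 0, 0, 0; -2, 0, 0; 0, 0, 0] := by
  rw [P2, Matrix.sub_mul, Matrix.one_mul, P1_mul_B8]
  ext i j
  fin_cases i <;> fin_cases j <;> simp [B8, tc] <;> ring

theorem P1_mul_C8_transpose : P1 * C8ᵀ =
    !![-(1/6), 0, 0; 0, 0, 0; -(1/3), 0, 0; 0, 0, 0; 0, -(1/3), 1/3; 5/6, 0, 0;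
      0, 1/6, -(1/6); 0, -(1/6), 1/6] := by
  ext i j
  fin_cases i <;> fin_cases j <;> simp [P1, C8, Matrix.mul_apply, Fin.sum_univ_succ]

theorem P2_mul_C8_transpose : P2 * C8ᵀ =
    !![1/6, 0, 0; 0, 0, 0; 1/3, 0, 0; 0, 0, 0; 0, 1/3, -(1/3); 1/6, 0, 0;
      0, 5/6, 1/6; 0, 1/6, 5/6] := by
  rw [P2, Matrix.sub_mul, Matrix.one_mul, P1_mul_C8_transpose]
  ext i j
  fin_cases i <;> fin_cases j <;> simp [C8] <;> norm_num

set_option maxHeartbeats 2000000 in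
theorem span_P1_mul_B8_P2_mul_B8_C8 :
    Submodule.span ℂ
      (Set.range ((P1 * B8)ᵀ) ∪ Set.range ((P2 * B8)ᵀ) ∪ Set.range ((C8ᴴ)ᵀ)) = ⊤ := by
  have h := sc_mul_sc
  refine span_cols_eq_top_of_mul_add_mul_add_mul_eq_one
    ((6 * sc) • !![0, 0, 0, 1, 0, 0, 0, 0;
      1/2, 0, 1, 0, 0, 0, 0, 0;
      -1/2, 0, 0, 0, 0, 0, 0, 0])
    ((6 * sc) • !![0, 0, 0, 0, -1, 0, 0, 0;
      0, -1, 0, 0, 0, 0, 0, 0;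
      0, 0, 0, 0, 0, 0, 0, 0])
    !![1, 0, 2, 0, 0, 1, 0, 0;
      0, 0, 0, 0, -2, 0, 1, 0;
      0, 0, 0, 0, 0, 0, 0, 1] ?_
  have h6 : sc * (6 * sc) = 1 := by linear_combination 6 * h
  rw [P1_mul_B8, P2_mul_B8, C8_conjTranspose]
  simp only [Matrix.smul_mul, Matrix.mul_smul, smul_smul, mul_comm (6 * sc) sc, h6, one_smul]
  ext i j
  fin_cases i <;> fin_cases j <;>
    simp [C8, Matrix.mul_apply, Fin.sum_univ_succ] <;> norm_num

set_option maxHeartbeats 2000000 in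
theorem span_B8_P1_mul_C8_P2_mul_C8 :
    Submodule.span ℂ
      (Set.range (B8ᵀ) ∪ Set.range ((P1 * C8ᴴ)ᵀ) ∪ Set.range ((P2 * C8ᴴ)ᵀ)) = ⊤ := by
  have h := sc_mul_sc
  refine span_cols_eq_top_of_mul_add_mul_add_mul_eq_one
    ((6 * sc) • !![0, 0, 0, 1, 0, 0, 0, 0;
      -1/3, -5/6, 1/6, 0, 0, 0, 0, 0;
      -1/3, 1/6, 1/6, 0, 0, 0, 0, 0])
    !![-1, -2, 0, 0, 0, 1, 0, 0;
      0, 0, 0, 0, -2, 0, 1, -1;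
      0, 0, 0, 0, 0, 0, 0, 0]
    !![1, 0, 2, 0, 0, 1, 0, 0;
      0, 0, 0, 5/2, 1/2, 0, 1, 0;
      0, 0, 0, -1/2, -1/2, 0, 0, 1] ?_
  rw [C8_conjTranspose, P1_mul_C8_transpose, P2_mul_C8_transpose]
  ext i j
  fin_cases i <;> fin_cases j <;>
    simp [B8, tc] <;> grind

theorem exists_submodule_finrank_eq_two {z1 z2 : ℂ} (h1 : z1 ≠ 0) :
    ∃ S : Submodule ℂ (Fin 8 → ℂ),
      (S : Set (Fin 8 → ℂ)) =
        {v | ∃ a b : ℂ, v = ![z1 * a, z2 * a, z1 * a, z1 * b, z2 * b, 0, 0, 0]} ∧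
      Module.finrank ℂ S = 2 := by
  let e : Fin 2 → Fin 8 → ℂ :=
    ![![z1, z2, z1, 0, 0, 0, 0, 0], ![0, 0, 0, z1, z2, 0, 0, 0]]
  have comb (a b : ℂ) :
      a • e 0 + b • e 1 = ![z1 * a, z2 * a, z1 * a, z1 * b, z2 * b, 0, 0, 0] := by
    ext i
    fin_cases i <;> simp [e, mul_comm]
  have hli : LinearIndependent ℂ e := by
    rw [Fintype.linearIndependent_iff]
    intro g hg
    rw [Fin.sum_univ_two, comb] at hg
    have h0 := congrFun hg 0
    have h3 := congrFun hg 3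
    simp [h1] at h0 h3
    exact Fin.forall_fin_two.mpr ⟨h0, h3⟩
  refine ⟨Submodule.span ℂ (Set.range e), ?_, by simpa using finrank_span_eq_card hli⟩
  ext v
  have hr : Set.range e = {e 0, e 1} := by
    ext w
    simp [Fin.exists_fin_two, eq_comm]
  rw [hr, SetLike.mem_coe, Submodule.mem_span_pair]
  simp only [comb, Set.mem_ofPred_eq, eq_comm]

theorem scattering_subspace_reducing {z1 z2 : ℂ}
    (h1 : z1 * (starRingEnd ℂ) z1 = 1) (h2 : z2 * (starRingEnd ℂ) z2 = 1) (a b : ℂ) :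
    C8.mulVec ![z1 * a, z2 * a, z1 * a, z1 * b, z2 * b, 0, 0, 0] = 0 ∧
    (B8ᴴ).mulVec (((z1 • P1 + z2 • P2)ᴴ).mulVec
      ![z1 * a, z2 * a, z1 * a, z1 * b, z2 * b, 0, 0, 0]) = 0 ∧
    ((z1 • P1 + z2 • P2) * A8).mulVec ![z1 * a, z2 * a, z1 * a, z1 * b, z2 * b, 0, 0, 0] =
      ![z1 * (2 * sc * b * z2), z2 * (2 * sc * b * z2), z1 * (2 * sc * b * z2),
        z1 * (3 * sc * a * z1), z2 * (3 * sc * a * z1), 0, 0, 0] ∧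
    (((z1 • P1 + z2 • P2) * A8)ᴴ).mulVec ![z1 * a, z2 * a, z1 * a, z1 * b, z2 * b, 0, 0, 0] =
      ![z1 * (2 * sc * b * (starRingEnd ℂ) z1), z2 * (2 * sc * b * (starRingEnd ℂ) z1),
        z1 * (2 * sc * b * (starRingEnd ℂ) z1), z1 * (3 * sc * a * (starRingEnd ℂ) z2),
        z2 * (3 * sc * a * (starRingEnd ℂ) z2), 0, 0, 0] := by
  have hA : A8.mulVec ![z1 * a, z2 * a, z1 * a, z1 * b, z2 * b, 0, 0, 0] =
      ![sc * b * (z1 + z2), 2 * sc * b * z2, 2 * sc * b * z1, 3 * sc * a * z1,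
        sc * a * (z1 + 2 * z2), sc * b * (z1 - z2), sc * a * (z1 - z2), sc * a * (z2 - z1)] := by
    ext i
    fin_cases i <;> simp [A8, tc, Matrix.mulVec, dotProduct, Fin.sum_univ_succ] <;> ring
  have hZ (z1 z2 : ℂ) (v : Fin 8 → ℂ) : (z1 • P1 + z2 • P2).mulVec v =
      (z1 - z2) • P1.mulVec v + z2 • v := by
    rw [P2, smul_sub, Matrix.add_mulVec, Matrix.sub_mulVec, Matrix.smul_mulVec,
      Matrix.smul_mulVec, Matrix.smul_mulVec, Matrix.one_mulVec, sub_smul]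
    abel
  have hZH : (z1 • P1 + z2 • P2)ᴴ =
      (starRingEnd ℂ) z1 • P1 + (starRingEnd ℂ) z2 • P2 := by
    simp [P2, P1_conjTranspose]
  set w1 := (starRingEnd ℂ) z1
  set w2 := (starRingEnd ℂ) z2
  refine ⟨?_, ?_, ?_, ?_⟩
  · ext i
    fin_cases i <;> simp [C8, Matrix.mulVec, dotProduct, Fin.sum_univ_succ]
  · rw [hZH, hZ, B8_conjTranspose]
    ext i
    fin_cases i <;>
      simp [B8, P1, tc, Matrix.mulVec, dotProduct, Fin.sum_univ_succ] <;> grind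
  · rw [← Matrix.mulVec_mulVec, hA, hZ]
    ext i
    fin_cases i <;>
      simp [P1] <;> ring
  · rw [Matrix.conjTranspose_mul, ← Matrix.mulVec_mulVec, hZH, hZ, A8_conjTranspose]
    ext i
    fin_cases i <;>
      simp [A8, P1, tc, Matrix.mulVec, dotProduct, Fin.sum_univ_succ] <;> grind

/-- **A strictly closely connected and shifted strictly closely connected GR-unitary
colligation that is not scattering minimal.**
(i) `P₁` is an orthogonal projection; (ii) `[[A, B], [C, 0]]` is unitary;
(iii) the columns of `P₁B, P₂B, C*` span `ℂ⁸`;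
(iv) the columns of `B, P₁C*, P₂C*` span `ℂ⁸`;
(v) for `|z₁| = |z₂| = 1` the two-dimensional subspace
`V(z) = {(z₁a, z₂a, z₁a, z₁b, z₂b, 0, 0, 0)ᵀ}` is annihilated by `C` and `B* Z(z)*`
and is invariant under `Z(z)A` and `(Z(z)A)*`. -/
theorem scc_not_scattering_minimal :
    (P1ᴴ = P1 ∧ P1 * P1 = P1) ∧
    (star (Matrix.fromBlocks A8 B8 C8 (0 : Matrix (Fin 3) (Fin 3) ℂ)) *
        Matrix.fromBlocks A8 B8 C8 (0 : Matrix (Fin 3) (Fin 3) ℂ) = 1 ∧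
      Matrix.fromBlocks A8 B8 C8 (0 : Matrix (Fin 3) (Fin 3) ℂ) *
        star (Matrix.fromBlocks A8 B8 C8 (0 : Matrix (Fin 3) (Fin 3) ℂ)) = 1) ∧
    Submodule.span ℂ
        (Set.range ((P1 * B8)ᵀ) ∪ Set.range ((P2 * B8)ᵀ) ∪ Set.range ((C8ᴴ)ᵀ)) = ⊤ ∧
    Submodule.span ℂ
        (Set.range (B8ᵀ) ∪ Set.range ((P1 * C8ᴴ)ᵀ) ∪ Set.range ((P2 * C8ᴴ)ᵀ)) = ⊤ ∧
    ∀ z1 z2 : ℂ, ‖z1‖ = 1 → ‖z2‖ = 1 →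
      (∃ S : Submodule ℂ (Fin 8 → ℂ),
        (S : Set (Fin 8 → ℂ)) =
          {v | ∃ a b : ℂ, v = ![z1 * a, z2 * a, z1 * a, z1 * b, z2 * b, 0, 0, 0]} ∧
        Module.finrank ℂ S = 2) ∧
      ∀ v ∈ {v : Fin 8 → ℂ |
          ∃ a b : ℂ, v = ![z1 * a, z2 * a, z1 * a, z1 * b, z2 * b, 0, 0, 0]},
        C8.mulVec v = 0 ∧
        (B8ᴴ).mulVec (((z1 • P1 + z2 • P2)ᴴ).mulVec v) = 0 ∧
        ((z1 • P1 + z2 • P2) * A8).mulVec v ∈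
          {v : Fin 8 → ℂ |
            ∃ a b : ℂ, v = ![z1 * a, z2 * a, z1 * a, z1 * b, z2 * b, 0, 0, 0]} ∧
        (((z1 • P1 + z2 • P2) * A8)ᴴ).mulVec v ∈
          {v : Fin 8 → ℂ |
            ∃ a b : ℂ, v = ![z1 * a, z2 * a, z1 * a, z1 * b, z2 * b, 0, 0, 0]} := by
  refine ⟨⟨P1_conjTranspose, P1_mul_P1⟩,
    ⟨star_fromBlocks_mul_self, mul_eq_one_comm.mp star_fromBlocks_mul_self⟩,
    span_P1_mul_B8_P2_mul_B8_C8, span_B8_P1_mul_C8_P2_mul_C8, fun z1 z2 h1 h2 => ⟨?_, ?_⟩⟩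
  · exact exists_submodule_finrank_eq_two (norm_ne_zero_iff.mp (by simp [h1]))
  · rintro v ⟨a, b, rfl⟩
    have hz (z : ℂ) (h : ‖z‖ = 1) : z * (starRingEnd ℂ) z = 1 := by
      simp [Complex.mul_conj', h]
    obtain ⟨hC, hB, hA, hAH⟩ := scattering_subspace_reducing (hz z1 h1) (hz z2 h2) a b
    exact ⟨hC, hB, ⟨_, _, hA⟩, ⟨_, _, hAH⟩⟩
end
end
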